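/- Let q be a prime power, l ≥ 1, t = q^l, and F = GF(t²) (so GF(q) ⊆ GF(t) ⊆ F). Let L = (α₁, …, αₙ) enumerate the set {α ∈ F : α ≠ 0 and α^t + α^{t−1} + 1 ≠ 0}. Then the q-ary Goppa codes Γ(L, (X^{t+1} + X^t + X)^{q−1}) and Γ(L, (X^t + X^{t−1} + 1)^{q−1}) coincide; that is, for every c ∈ GF(q)ⁿ, (X^t + X^{t−1} + 1)^{q−1} divides Σᵢ cᵢ ∏_{j≠i}(X − αⱼ) in F[X] if and only if (X^{t+1} + X^t + X)^{q−1} divides Σᵢ cᵢ ∏_{j≠i}(X − αⱼ) in F[X]. -/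

import Mathlib

open Polynomial

/-- The syndrome polynomial `Σᵢ cᵢ ∏_{j≠i} (X − αⱼ)` of a word `c ∈ GF(q)ⁿ` with respect to
the locator tuple `α`, with coefficients viewed in the extension field `F`. -/
noncomputable def goppaSum {K F : Type*} [Field K] [Field F] [Algebra K F] {n : ℕ}
    (α : Fin n → F) (c : Fin n → K) : Polynomial F :=
  ∑ i, Polynomial.C (algebraMap K F (c i)) *
    ∏ j ∈ Finset.univ.erase i, (Polynomial.X - Polynomial.C (α j))

section Goppa

variable {K F : Type*} [Field K] [Field F] [Algebra K F] {n : ℕ} {α : Fin n → F} {c : Fin n → K}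

theorem degree_goppaSum_lt (α : Fin n → F) (c : Fin n → K) : (goppaSum α c).degree < n := by
  rw [← mem_degreeLT]
  refine Submodule.sum_mem _ fun i _ => mem_degreeLT.mpr ?_
  have hn : 0 < n := i.pos
  refine (degree_mul_le _ _).trans_lt ?_
  rw [degree_prod]
  simp only [degree_X_sub_C, Finset.sum_const, Finset.card_erase_of_mem (Finset.mem_univ i),
    Finset.card_univ, Fintype.card_fin, nsmul_one]
  refine (add_le_add_left degree_C_le _).trans_lt ?_
  rw [zero_add]
  exact_mod_cast Nat.sub_lt hn one_pos

theorem eval_goppaSum (α : Fin n → F) (c : Fin n → K) (i : Fin n) :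
    (goppaSum α c).eval (α i) =
      algebraMap K F (c i) * ∏ j ∈ Finset.univ.erase i, (α i - α j) := by
  rw [goppaSum, eval_finsetSum, Finset.sum_eq_single i]
  · simp [eval_prod]
  · intro k _ hk
    rw [eval_mul, eval_prod, Finset.prod_eq_zero (i := i) (by simp [hk.symm]) (by simp), mul_zero]
  · simp

theorem sum_mul_eval_div_eq_zero (hα : Function.Injective α) {G P : F[X]}
    (hG : ∀ i, G.eval (α i) ≠ 0) (h : G ∣ goppaSum α c) (hP : P.degree < G.degree) :
    ∑ i, algebraMap K F (c i) * (P.eval (α i) / G.eval (α i)) = 0 := by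
  obtain ⟨Q, hQ⟩ := h
  have hlt := degree_goppaSum_lt α c
  rw [hQ] at hlt
  have hdeg : (P * Q).degree < (n : WithBot ℕ) ∧ (P * Q).coeff (n - 1) = 0 := by
    by_cases hQ0 : Q = 0
    · simp [hQ0]
    have hPQ : (P * Q).degree < (G * Q).degree := by
      rw [degree_mul, degree_mul]
      exact WithBot.add_lt_add_right (degree_ne_bot.mpr hQ0) hP
    refine ⟨hPQ.trans hlt, coeff_eq_zero_of_degree_lt (hPQ.trans_le ?_)⟩
    have hGQ : G * Q ≠ 0 := fun h0 => by simp [h0] at hPQ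
    rw [degree_eq_natDegree hGQ] at hlt ⊢
    norm_cast at hlt ⊢
    omega
  have hsum := Lagrange.coeff_eq_sum (s := Finset.univ) (v := α) hα.injOn (P := P * Q)
    (by simpa using hdeg.1)
  rw [Finset.card_univ, Fintype.card_fin, hdeg.2] at hsum
  rw [hsum]
  refine Finset.sum_congr rfl fun i _ => ?_
  have hprod : ∏ j ∈ Finset.univ.erase i, (α i - α j) ≠ 0 :=
    Finset.prod_ne_zero_iff.mpr fun j hj =>
      sub_ne_zero.mpr fun hij => (Finset.ne_of_mem_erase hj) (hα hij).symm
  have hev := eval_goppaSum α c i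
  rw [hQ, eval_mul] at hev
  rw [eval_mul, mul_div_assoc', div_eq_div_iff (hG i) hprod]
  linear_combination -P.eval (α i) * hev

theorem X_sub_C_pow_dvd_goppaSum {u : F} {k : ℕ} (hu : ∀ i, α i ≠ u)
    (h : ∀ m, 1 ≤ m → m ≤ k → ∑ i, algebraMap K F (c i) * ((α i - u) ^ m)⁻¹ = 0) :
    (X - C u) ^ k ∣ goppaSum α c := by
  have hu' : ∀ i, α i - u ≠ 0 := fun i => sub_ne_zero.mpr (hu i)
  have hgeom : ∀ i, (X - C u) ^ k * C (((α i - u) ^ k)⁻¹) - 1 =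
      (∑ m ∈ Finset.range k, (X - C u) ^ m * C (((α i - u) ^ (m + 1))⁻¹)) * (X - C (α i)) := by
    intro i
    have hg := geom_sum₂_mul (X - C u) (C (α i - u)) k
    have hsub : X - C u - C (α i - u) = X - C (α i) := by rw [C_sub]; ring
    have hC : C ((α i - u) ^ k) * C (((α i - u) ^ k)⁻¹) = 1 := by
      rw [← C_mul, mul_inv_cancel₀ (pow_ne_zero _ (hu' i)), C_1]
    have hsum : ∑ m ∈ Finset.range k, (X - C u) ^ m * C (((α i - u) ^ (m + 1))⁻¹) =
        (∑ m ∈ Finset.range k, (X - C u) ^ m * C (α i - u) ^ (k - 1 - m)) *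
          C (((α i - u) ^ k)⁻¹) := by
      rw [Finset.sum_mul]
      refine Finset.sum_congr rfl fun m hm => ?_
      rw [mul_assoc, ← C_pow, ← C_mul]
      congr 2
      have hk : k = (k - 1 - m) + (m + 1) := by have := Finset.mem_range.mp hm; omega
      have h1 := pow_ne_zero (k - 1 - m) (hu' i)
      conv_rhs => rw [show (α i - u) ^ k = (α i - u) ^ (k - 1 - m) * (α i - u) ^ (m + 1) by
        rw [← pow_add, ← hk]]
      rw [mul_inv, mul_inv_cancel_left₀ h1]
    rw [hsum, mul_right_comm, ← hsub, hg, sub_mul, ← C_pow, hC]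
  have hzero : ∑ i, C (algebraMap K F (c i)) *
      (∑ m ∈ Finset.range k, (X - C u) ^ m * C (((α i - u) ^ (m + 1))⁻¹)) = 0 := by
    simp_rw [Finset.mul_sum]
    rw [Finset.sum_comm]
    refine Finset.sum_eq_zero fun m hm => ?_
    simp_rw [mul_left_comm (C _) ((X - C u) ^ m), ← C_mul]
    rw [← Finset.mul_sum, ← map_sum, h (m + 1) (by omega) (Finset.mem_range.mp hm), C_0, mul_zero]
  refine ⟨∑ i, C (algebraMap K F (c i)) * C (((α i - u) ^ k)⁻¹) *
    ∏ j ∈ Finset.univ.erase i, (X - C (α j)), ?_⟩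
  rw [eq_comm, ← sub_eq_zero, goppaSum, Finset.mul_sum, ← Finset.sum_sub_distrib]
  calc _ = ∑ i, (C (algebraMap K F (c i)) *
      (∑ m ∈ Finset.range k, (X - C u) ^ m * C (((α i - u) ^ (m + 1))⁻¹))) *
        ∏ j, (X - C (α j)) := Finset.sum_congr rfl fun i _ => by
        rw [← Finset.mul_prod_erase _ _ (Finset.mem_univ i)]
        linear_combination (C (algebraMap K F (c i)) *
          ∏ j ∈ Finset.univ.erase i, (X - C (α j))) * hgeom i
    _ = 0 := by rw [← Finset.sum_mul, hzero, zero_mul]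

theorem sum_algebraMap_mul_pow_card_pow [Fintype K] (l : ℕ) (c : Fin n → K) (f : Fin n → F) :
    (∑ i, algebraMap K F (c i) * f i) ^ Fintype.card K ^ l =
      ∑ i, algebraMap K F (c i) * f i ^ Fintype.card K ^ l := by
  have hpow : ∀ x : F, x ^ Fintype.card K ^ l = (FiniteField.frobeniusAlgHom K F ^ l) x :=
    fun x => by rw [AlgHom.coe_pow, FiniteField.coe_frobeniusAlgHom, pow_iterate]
  simp only [hpow, map_sum, map_mul, AlgHom.commutes]

theorem add_pow_card_pow_of_algebra (K : Type*) {R : Type*} [Field K] [Fintype K] [CommRing R] [Algebra K R]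
    (l : ℕ) (x y : R) :
    (x + y) ^ Fintype.card K ^ l = x ^ Fintype.card K ^ l + y ^ Fintype.card K ^ l := by
  have hpow : ∀ x : R, x ^ Fintype.card K ^ l = (FiniteField.frobeniusAlgHom K R ^ l) x :=
    fun x => by rw [AlgHom.coe_pow, FiniteField.coe_frobeniusAlgHom, pow_iterate]
  simp only [hpow, map_add]

/-- For a polynomial with simple roots, all of them in `F`, the Goppa codes of its `(q - 1)`-st
and `q`-th powers coincide. -/
theorem pow_card_dvd_goppaSum [Fintype K] [Fintype F] (hα : Function.Injective α) {G : F[X]}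
    (hmonic : G.Monic) (hsplit : G ∣ X ^ Fintype.card F - X) (hG : ∀ i, G.eval (α i) ≠ 0)
    (h : G ^ (Fintype.card K - 1) ∣ goppaSum α c) : G ^ Fintype.card K ∣ goppaSum α c := by
  classical
  have hK : 1 < Fintype.card K := Fintype.one_lt_card
  have hne : (X ^ Fintype.card F - X : F[X]) ≠ 0 :=
    FiniteField.X_pow_card_sub_X_ne_zero F Fintype.one_lt_card
  have hs : (X ^ Fintype.card F - X : F[X]).Splits := by
    rw [splits_iff_card_roots, FiniteField.roots_X_pow_card_sub_X,
      FiniteField.X_pow_card_sub_X_natDegree_eq F Fintype.one_lt_card]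
    rfl
  have hnodup : G.roots.Nodup := by
    refine Multiset.nodup_of_le (roots.le_of_dvd hne hsplit) ?_
    rw [FiniteField.roots_X_pow_card_sub_X]
    exact Finset.univ.nodup
  have hprod : G = ∏ u ∈ G.roots.toFinset, (X - C u) := by
    conv_lhs => rw [(hs.of_dvd hne hsplit).eq_prod_roots_of_monic hmonic]
    rw [Finset.prod_eq_multiset_prod, Multiset.toFinset_val, hnodup.dedup]
  rw [hprod, ← Finset.prod_pow]
  refine Finset.prod_dvd_of_coprime (fun u _ v _ huv =>
    ((pairwise_coprime_X_sub_C Function.injective_id) huv).pow) fun u hu => ?_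
  have hroot : G.eval u = 0 := by simpa using (mem_roots'.mp (Multiset.mem_toFinset.mp hu)).2
  have hu : ∀ i, α i ≠ u := fun i hi => hG i (hi ▸ hroot)
  have hdvd : (X - C u) ^ (Fintype.card K - 1) ∣ goppaSum α c :=
    (pow_dvd_pow_of_dvd (dvd_iff_isRoot.mpr hroot) _).trans h
  have hsum : ∀ m, 1 ≤ m → m ≤ Fintype.card K - 1 →
      ∑ i, algebraMap K F (c i) * ((α i - u) ^ m)⁻¹ = 0 := by
    intro m hm hmK
    have hz := sum_mul_eval_div_eq_zero hα (c := c)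
      (G := (X - C u) ^ (Fintype.card K - 1)) (P := (X - C u) ^ (Fintype.card K - 1 - m))
      (fun i => by simpa using fun h0 => absurd h0 (sub_ne_zero.mpr (hu i))) hdvd
      (by simp only [degree_pow, degree_X_sub_C, nsmul_one]; norm_cast; omega)
    rw [← hz]
    refine Finset.sum_congr rfl fun i _ => ?_
    have h0 := sub_ne_zero.mpr (hu i)
    simp only [eval_pow, eval_sub, eval_X, eval_C]
    rw [pow_sub₀ _ h0 hmK, mul_div_right_comm, div_self (pow_ne_zero _ h0), one_mul]
  refine X_sub_C_pow_dvd_goppaSum hu fun m hm hmK => ?_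
  rcases hmK.eq_or_lt with rfl | hlt
  · have hz := sum_algebraMap_mul_pow_card_pow 1 c fun i => ((α i - u) ^ 1)⁻¹
    rw [hsum 1 le_rfl (by omega), pow_one, zero_pow (by omega)] at hz
    simpa using hz.symm
  · exact hsum m hm (by omega)

end Goppa

theorem X_pow_add_X_pow_add_one_dvd (K : Type*) {F : Type*} [Field K] [Fintype K] [Field F]
    [Algebra K F] {t : ℕ} (l : ℕ) (ht : t = Fintype.card K ^ l) :
    (X ^ t + X ^ (t - 1) + 1 : F[X]) ∣ X ^ t ^ 2 - X := by
  have ht0 : 0 < t := ht ▸ pow_pos Fintype.card_pos l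
  have hadd : ∀ x y : F[X], (x + y) ^ t = x ^ t + y ^ t := fun x y => by
    rw [ht]; exact add_pow_card_pow_of_algebra K l x y
  have hX : (X : F[X]) ^ (t - 1) * X = X ^ t := by rw [← pow_succ, Nat.sub_add_cancel ht0]
  have hshift : (X ^ t + X ^ (t - 1) + 1 : F[X]) ∣ (X + 1) ^ (t + 1) - 1 :=
    ⟨X, by rw [pow_succ, hadd, one_pow]; linear_combination -hX⟩
  have hpow : ((X + 1) ^ (t + 1) - 1 : F[X]) ∣ ((X + 1) ^ (t + 1)) ^ (t - 1) - 1 :=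
    sub_one_dvd_pow_sub_one _ _
  refine (hshift.trans hpow).trans ⟨X + 1, ?_⟩
  have hexp : t ^ 2 = (t + 1) * (t - 1) + 1 := by
    obtain ⟨s, rfl⟩ := Nat.exists_eq_add_of_lt ht0
    simp; ring
  have hsq : (X + 1 : F[X]) ^ t ^ 2 = X ^ t ^ 2 + 1 := by
    rw [pow_two, pow_mul, hadd, one_pow, hadd, one_pow, ← pow_mul]
  rw [← pow_mul, sub_mul, ← pow_succ, ← hexp, hsq]
  ring

/-- The value of `X ^ (t + 1) + X ^ t + X` at an element of `GF(t²)` lies in `GF(t)`. -/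
theorem trace_add_norm_pow {K F : Type*} [Field K] [Fintype K] [Field F] [Fintype F] [Algebra K F]
    {t : ℕ} (l : ℕ) (ht : t = Fintype.card K ^ l) (hF : Fintype.card F = t ^ 2) (x : F) :
    (x ^ (t + 1) + x ^ t + x) ^ t = x ^ (t + 1) + x ^ t + x := by
  have hadd : ∀ x y : F, (x + y) ^ t = x ^ t + y ^ t := fun x y => by
    rw [ht]; exact add_pow_card_pow_of_algebra K l x y
  have hx : (x ^ t) ^ t = x := by rw [← pow_mul, ← pow_two, ← hF, FiniteField.pow_card]
  rw [hadd, hadd, pow_succ, mul_pow, hx]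
  ring

theorem inv_pow_eq_of_pow_eq {F : Type*} [Field F] {q t m : ℕ} (hm : m < q) (ht : 2 ≤ t)
    {x : F} (hx : x ≠ 0) (hg : x ^ t + x ^ (t - 1) + 1 ≠ 0)
    (hpow : (x ^ t + x ^ (t - 1) + 1) ^ q = x ^ (t * q) + x ^ ((t - 1) * q) + 1) :
    (x ^ m)⁻¹ = x ^ (q - m) / (x ^ (t + 1) + x ^ t + x) ^ q +
      (x ^ (t * q - m) + x ^ ((t - 1) * q - m)) / (x ^ t + x ^ (t - 1) + 1) ^ q := by
  have hT : x ^ (t + 1) + x ^ t + x = x * (x ^ t + x ^ (t - 1) + 1) := by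
    rw [mul_add, mul_add, ← pow_succ', ← pow_succ', Nat.sub_add_cancel (by omega), mul_one]
  have h1 : m ≤ (t - 1) * q := hm.le.trans (Nat.le_mul_of_pos_left q (by omega))
  have h2 : m ≤ t * q := hm.le.trans (Nat.le_mul_of_pos_left q (by omega))
  have hg' := pow_ne_zero q hg
  rw [hT, mul_pow, pow_sub₀ x hx hm.le, pow_sub₀ x hx h1, pow_sub₀ x hx h2, ← div_div,
    mul_div_right_comm, div_self (pow_ne_zero _ hx), one_mul, ← add_div, eq_div_iff hg', hpow]
  ring

/-- with `t = q^l`, `F = GF(t²)` and `L` enumerating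
`{α ∈ F : α ≠ 0 ∧ α^t + α^{t−1} + 1 ≠ 0}`, the codes `Γ(L, (X^{t+1} + X^t + X)^{q−1})` and
`Γ(L, (X^t + X^{t−1} + 1)^{q−1})` coincide. -/
theorem goppa_G5_eq_G4_pow_q_sub_one {K F : Type*} [Field K] [Fintype K]
    [Field F] [Fintype F] [Algebra K F]
    (q l : ℕ) (hq : Fintype.card K = q) (hl : 1 ≤ l)
    (hF : Fintype.card F = (q ^ l) ^ 2)
    {n : ℕ} (α : Fin n → F) (hα : Function.Injective α)
    (hrange : ∀ x : F, x ∈ Set.range α ↔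
      (x ≠ 0 ∧ x ^ (q ^ l) + x ^ (q ^ l - 1) + 1 ≠ 0))
    (c : Fin n → K) :
    ((Polynomial.X ^ (q ^ l) + Polynomial.X ^ (q ^ l - 1) + 1) ^ (q - 1) ∣
        goppaSum α c) ↔
      ((Polynomial.X ^ (q ^ l + 1) + Polynomial.X ^ (q ^ l) + Polynomial.X) ^ (q - 1) ∣
        goppaSum α c) := by
  subst hq
  have hK : 1 < Fintype.card K := Fintype.one_lt_card
  obtain ⟨t, ht⟩ : ∃ t, t = Fintype.card K ^ l := ⟨_, rfl⟩
  rw [← ht] at hF hrange ⊢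
  set q := Fintype.card K with hq
  have hqt : q ∣ t := ht ▸ dvd_pow_self q (by omega)
  have ht2 : 2 ≤ t := hK.trans_le (Nat.le_of_dvd (ht ▸ pow_pos (by omega) l) hqt)
  have hG5 : (X ^ (t + 1) + X ^ t + X : F[X]) = X * (X ^ t + X ^ (t - 1) + 1) := by
    rw [mul_add, mul_add, ← pow_succ', ← pow_succ', Nat.sub_add_cancel (by omega), mul_one]
  rw [hG5, mul_pow]
  refine ⟨fun h => ?_, fun h => (dvd_mul_left _ _).trans h⟩
  have hα0 : ∀ i, α i ≠ 0 := fun i => ((hrange (α i)).mp ⟨i, rfl⟩).1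
  have hG0 : ∀ i, α i ^ t + α i ^ (t - 1) + 1 ≠ 0 := fun i => ((hrange (α i)).mp ⟨i, rfl⟩).2
  have hdeg : (X ^ (t - 1) + 1 : F[X]).degree < t := by
    rw [← C_1, degree_X_pow_add_C (by omega)]
    exact_mod_cast Nat.sub_lt (by omega) one_pos
  have hmonic : (X ^ t + X ^ (t - 1) + 1 : F[X]).Monic := by
    rw [add_assoc]; exact monic_X_pow_add hdeg
  have hdegG : (X ^ t + X ^ (t - 1) + 1 : F[X]).degree = t := by
    rw [add_assoc, degree_add_eq_left_of_degree_lt (by rwa [degree_X_pow]), degree_X_pow]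
  have hdegGq : ((X ^ t + X ^ (t - 1) + 1 : F[X]) ^ q).degree = (t * q : ℕ) := by
    rw [degree_pow, hdegG, mul_comm t q, nsmul_eq_mul, Nat.cast_mul]
  have hdvd : (X ^ t + X ^ (t - 1) + 1) ^ q ∣ goppaSum α c :=
    pow_card_dvd_goppaSum hα hmonic (hF ▸ X_pow_add_X_pow_add_one_dvd K l ht)
      (by simpa using hG0) h
  have hcheck : ∀ P : F[X], P.degree < (t * q : ℕ) → ∑ i, algebraMap K F (c i) *
      (P.eval (α i) / (α i ^ t + α i ^ (t - 1) + 1) ^ q) = 0 := fun P hP => by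
    simpa using sum_mul_eval_div_eq_zero hα (fun i => by simpa using fun h0 => absurd h0 (hG0 i))
      hdvd (hdegGq ▸ hP)
  have hcop : IsCoprime (X : F[X]) (X ^ t + X ^ (t - 1) + 1) := by
    refine ⟨-(X ^ (t - 1) + X ^ (t - 2)), 1, ?_⟩
    have h1 : (X : F[X]) ^ (t - 1) * X = X ^ t := by rw [← pow_succ, Nat.sub_add_cancel (by omega)]
    have h2 : (X : F[X]) ^ (t - 2) * X = X ^ (t - 1) := by
      rw [← pow_succ]; congr 1; omega
    linear_combination -h1 - h2
  refine hcop.pow.mul_dvd ?_ h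
  rw [← sub_zero (X : F[X]), ← C_0]
  refine X_sub_C_pow_dvd_goppaSum hα0 fun m hm hmq => ?_
  have hm' : m < q := by omega
  have hfrob : ∀ i, (α i ^ t + α i ^ (t - 1) + 1) ^ q =
      α i ^ (t * q) + α i ^ ((t - 1) * q) + 1 := fun i => by
    have hadd := add_pow_card_pow_of_algebra K (R := F) 1
    simp only [pow_one, ← hq] at hadd
    rw [hadd, hadd, one_pow, pow_mul, pow_mul]
  have hlow : ∑ i, algebraMap K F (c i) *
      (α i ^ (q - m) / (α i ^ (t + 1) + α i ^ t + α i) ^ q) = 0 := by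
    have hle : q ≤ (q - m) * t :=
      (Nat.le_of_dvd (by omega) hqt).trans (Nat.le_mul_of_pos_left t (by omega))
    have hlt : (q - m) * t - q < t * q := by
      have := Nat.mul_le_mul_right t (Nat.sub_le q m)
      rw [mul_comm q t] at this
      omega
    have hpow : (∑ i, algebraMap K F (c i) *
        (α i ^ (q - m) / (α i ^ (t + 1) + α i ^ t + α i) ^ q)) ^ t = 0 := by
      rw [ht, sum_algebraMap_mul_pow_card_pow, ← hq, ← ht,
        ← hcheck (X ^ ((q - m) * t - q)) (by rw [degree_X_pow]; exact_mod_cast hlt)]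
      refine Finset.sum_congr rfl fun i _ => ?_
      have hT : α i ^ (t + 1) + α i ^ t + α i = α i * (α i ^ t + α i ^ (t - 1) + 1) := by
        simpa using congrArg (eval (α i)) hG5
      rw [div_pow, pow_right_comm (α i ^ (t + 1) + α i ^ t + α i),
        trace_add_norm_pow l ht hF, hT, mul_pow, ← div_div, ← pow_mul, eval_pow, eval_X,
        pow_sub₀ _ (hα0 i) hle, div_eq_mul_inv (α i ^ _)]
    exact pow_eq_zero_iff (by omega) |>.mp hpow
  have hhigh := hcheck (X ^ (t * q - m) + X ^ ((t - 1) * q - m)) <| by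
    have hpos : 0 < t * q := by positivity
    have hle : (t - 1) * q ≤ t * q := Nat.mul_le_mul_right q (Nat.sub_le t 1)
    have hlt : (t - 1) * q < t * q := Nat.mul_lt_mul_of_pos_right (by omega) (by omega)
    refine (degree_add_le _ _).trans_lt (max_lt ?_ ?_) <;> rw [degree_X_pow] <;> norm_cast <;> omega
  have hsum := congrArg₂ (· + ·) hlow hhigh
  simp only [add_zero, ← Finset.sum_add_distrib] at hsum
  refine (Finset.sum_congr rfl fun i _ => ?_).trans hsum
  rw [sub_zero, inv_pow_eq_of_pow_eq hm' ht2 (hα0 i) (hG0 i) (hfrob i), mul_add]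
  simp
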